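/- arXiv:2011.14335 — 2 statements merged into one kernel-verified Lean document; each statement's English description precedes it below -/
import Mathlib

section
/- Let S be a pseudogroup and let (X, p) be a left S-module. If a family (xᵢ)_{i∈I} of elements of X has a join ⋁ᵢ xᵢ in X, then p(⋁ᵢ xᵢ) = ⋁ᵢ p(xᵢ) in E(S). -/
namespace PseudogroupMorita

/-- An inverse semigroup: a semigroup in which every element `a` has a unique
inverse `a⁻¹` satisfying `a * a⁻¹ * a = a` and `a⁻¹ * a * a⁻¹ = a⁻¹`. -/
class InverseSemigroup (S : Type*) extends Semigroup S, Inv S where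
  mul_inv_mul : ∀ a : S, a * a⁻¹ * a = a
  inv_mul_inv : ∀ a : S, a⁻¹ * a * a⁻¹ = a⁻¹
  inv_unique : ∀ a b : S, a * b * a = a → b * a * b = b → b = a⁻¹

/-- `a` is an idempotent. -/
def IsIdem {S : Type*} [Mul S] (a : S) : Prop := a * a = a

/-- The natural partial order: `a ≤ b` iff `a = e * b` for some idempotent `e`. -/
def nle {S : Type*} [Mul S] (a b : S) : Prop := ∃ e : S, IsIdem e ∧ a = e * b

/-- `s` and `t` are left compatible: `s⁻¹ * t` is an idempotent. -/
def LeftCompat {S : Type*} [Mul S] [Inv S] (s t : S) : Prop := IsIdem (s⁻¹ * t)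

/-- `s` and `t` are right compatible: `s * t⁻¹` is an idempotent. -/
def RightCompat {S : Type*} [Mul S] [Inv S] (s t : S) : Prop := IsIdem (s * t⁻¹)

/-- `s` and `t` are compatible. -/
def Compat {S : Type*} [Mul S] [Inv S] (s t : S) : Prop := LeftCompat s t ∧ RightCompat s t

/-- A compatible subset: any two of its elements are compatible. -/
def CompatSet {S : Type*} [Mul S] [Inv S] (A : Set S) : Prop := ∀ a ∈ A, ∀ b ∈ A, Compat a b

/-- `j` is the join (least upper bound) of `A` with respect to the natural partial order. -/
def IsJoin {S : Type*} [Mul S] (A : Set S) (j : S) : Prop :=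
  (∀ a ∈ A, nle a j) ∧ ∀ b : S, (∀ a ∈ A, nle a b) → nle j b

/-- A pseudogroup: an inverse semigroup in which every compatible subset has a join
and multiplication distributes over such joins. -/
class Pseudogroup (S : Type*) extends InverseSemigroup S where
  joins_exist : ∀ A : Set S, CompatSet A → ∃ j : S, IsJoin A j
  mul_join_left : ∀ (s : S) (A : Set S) (j : S), CompatSet A → IsJoin A j →
    IsJoin ((fun a => s * a) '' A) (s * j)
  mul_join_right : ∀ (s : S) (A : Set S) (j : S), CompatSet A → IsJoin A j →
    IsJoin ((fun a => a * s) '' A) (j * s)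

/-- `A^∨`: the set of all joins of compatible subsets of `A`. -/
def supClosure {S : Type*} [Mul S] [Inv S] (A : Set S) : Set S :=
  {j | ∃ C : Set S, C ⊆ A ∧ CompatSet C ∧ IsJoin C j}

/-- The underlying set of the local semigroup `eSe`. -/
def locSet {S : Type*} [Mul S] (e : S) : Set S := {u : S | u = e * u * e}

/-- The set `A * B * C` of triple products. -/
def tripleProd {S : Type*} [Mul S] (A B C : Set S) : Set S :=
  {x : S | ∃ a ∈ A, ∃ b ∈ B, ∃ c ∈ C, x = a * b * c}

/-- A (two-sided) semigroup ideal. -/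
def SemigroupIdeal {S : Type*} [Mul S] (I : Set S) : Prop :=
  ∀ s : S, ∀ a ∈ I, s * a ∈ I ∧ a * s ∈ I

/-- A sup-ideal: an ideal closed under arbitrary compatible joins. -/
def IsSupIdeal {S : Type*} [Mul S] [Inv S] (I : Set S) : Prop :=
  SemigroupIdeal I ∧ ∀ C : Set S, C ⊆ I → CompatSet C → ∀ j : S, IsJoin C j → j ∈ I

/-- A pencil from `e` to `f`: a subset `X` with `e = ⋁_{x ∈ X} d x` and `f ≥ ⋁_{x ∈ X} r x`. -/
def IsPencil {S : Type*} [Mul S] [Inv S] (X : Set S) (e f : S) : Prop :=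
  IsJoin ((fun x => x⁻¹ * x) '' X) e ∧
  ∃ j : S, IsJoin ((fun x => x * x⁻¹) '' X) j ∧ nle j f

/-- `e ⪯ f` iff there is a pencil from `e` to `f`. -/
def PencilLE {S : Type*} [Mul S] [Inv S] (e f : S) : Prop := ∃ X : Set S, IsPencil X e f

/-- A sup-ideal of the (local) pseudogroup whose underlying set is `A`. -/
def IsSupIdealIn {S : Type*} [Mul S] [Inv S] (A I : Set S) : Prop :=
  I ⊆ A ∧ (∀ s ∈ A, ∀ a ∈ I, s * a ∈ I ∧ a * s ∈ I) ∧
  ∀ C : Set S, C ⊆ I → CompatSet C → ∀ j : S, IsJoin C j → j ∈ I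

/-- The (local) pseudogroup with underlying set `A` and least element `z` is 0-simplifying:
its only sup-ideals are `{z}` and `A` itself. -/
def ZeroSimplifyingIn {S : Type*} [Mul S] [Inv S] (A : Set S) (z : S) : Prop :=
  ∀ I : Set S, IsSupIdealIn A I → I = {z} ∨ I = A

/-- The (local) inverse semigroup with underlying set `A` is fundamental: any of its
elements commuting with all of its idempotents is an idempotent. -/
def FundamentalIn {S : Type*} [Mul S] (A : Set S) : Prop :=
  ∀ a ∈ A, (∀ g ∈ A, IsIdem g → a * g = g * a) → IsIdem a

/-- A supported left action of an inverse semigroup `S` on a set `X`. -/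
structure SupportedAction (S : Type*) [InverseSemigroup S] (X : Type*) where
  act : S → X → X
  act_mul : ∀ (s t : S) (x : X), act (s * t) x = act s (act t x)
  p : X → S
  p_idem : ∀ x : X, IsIdem (p x)
  p_act : ∀ x : X, act (p x) x = x
  p_conj : ∀ (s : S) (x : X), p (act s x) = s * p x * s⁻¹

namespace SupportedAction

variable {S : Type*} [InverseSemigroup S] {X Y : Type*}

/-- `x` and `y` are left compatible: `p(x) y = p(y) x`. -/
def LCompat (M : SupportedAction S X) (x y : X) : Prop :=
  M.act (M.p x) y = M.act (M.p y) x

/-- A left compatible subset of `X`. -/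
def LCompatSet (M : SupportedAction S X) (A : Set X) : Prop :=
  ∀ x ∈ A, ∀ y ∈ A, M.LCompat x y

/-- The order on `X`: `x ≤ y` iff `x = e • y` for some idempotent `e`. -/
def xle (M : SupportedAction S X) (x y : X) : Prop :=
  ∃ e : S, IsIdem e ∧ x = M.act e y

/-- `j` is the join of `A ⊆ X`. -/
def IsJoinX (M : SupportedAction S X) (A : Set X) (j : X) : Prop :=
  (∀ a ∈ A, M.xle a j) ∧ ∀ b : X, (∀ a ∈ A, M.xle a b) → M.xle j b

/-- `m` is the (binary) meet of `x` and `y` in `X`. -/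
def IsMeetX (M : SupportedAction S X) (x y m : X) : Prop :=
  M.xle m x ∧ M.xle m y ∧ ∀ z : X, M.xle z x → M.xle z y → M.xle z m

/-- The action is pointed, with minimum `z ∈ X` and `zS` the least element of `S`:
`s • z = z` and `zS • x = z`. -/
def Pointed (M : SupportedAction S X) (z : X) (zS : S) : Prop :=
  (∀ x : X, M.xle z x) ∧ (∀ s : S, M.act s z = z) ∧ (∀ x : X, M.act zS x = z)

/-- A homomorphism of supported left `S`-actions. -/
def IsActHom (M : SupportedAction S X) (N : SupportedAction S Y) (θ : X → Y) : Prop :=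
  (∀ (s : S) (x : X), θ (M.act s x) = N.act s (θ x)) ∧ ∀ x : X, N.p (θ x) = M.p x

end SupportedAction

/-- A left `S`-module over a pseudogroup `S`: a supported left action such that every
left compatible subset of `X` has a join, the action distributes over left compatible
joins, and joins of compatible subsets of `S` act as joins. -/
structure SMod (S : Type*) [Pseudogroup S] (X : Type*) extends SupportedAction S X where
  joinsX : ∀ A : Set X, toSupportedAction.LCompatSet A → ∃ j : X, toSupportedAction.IsJoinX A j
  act_joinX : ∀ (s : S) (A : Set X) (j : X), toSupportedAction.LCompatSet A →
    toSupportedAction.IsJoinX A j →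
    toSupportedAction.IsJoinX (toSupportedAction.act s '' A) (toSupportedAction.act s j)
  join_act : ∀ (A : Set S) (j : S), CompatSet A → IsJoin A j → ∀ x : X,
    toSupportedAction.IsJoinX ((fun s => toSupportedAction.act s x) '' A)
      (toSupportedAction.act j x)

/-- A homomorphism of left `S`-modules: a homomorphism of the underlying supported
actions preserving all left compatible joins. -/
def IsModHom {S X Y : Type*} [Pseudogroup S] (M : SMod S X) (N : SMod S Y) (θ : X → Y) : Prop :=
  SupportedAction.IsActHom M.toSupportedAction N.toSupportedAction θ ∧
  ∀ (A : Set X) (j : X), M.toSupportedAction.LCompatSet A → M.toSupportedAction.IsJoinX A j →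
    N.toSupportedAction.IsJoinX (θ '' A) (θ j)

/-- `L(X)`: the set of left compatible order-ideals of a supported action `X`. -/
abbrev LIdeal {S : Type*} [InverseSemigroup S] {X : Type*} (M : SupportedAction S X) : Type _ :=
  {A : Set X // (∀ x y : X, M.xle x y → y ∈ A → x ∈ A) ∧ M.LCompatSet A}

/-- An `(S,T)`-biaction with inner products. -/
structure Biaction (S T : Type*) [InverseSemigroup S] [InverseSemigroup T] (X : Type*) where
  actL : S → X → X
  actL_mul : ∀ (s t : S) (x : X), actL (s * t) x = actL s (actL t x)
  actR : X → T → X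
  actR_mul : ∀ (x : X) (t u : T), actR x (t * u) = actR (actR x t) u
  actLR : ∀ (s : S) (x : X) (t : T), actR (actL s x) t = actL s (actR x t)
  ip : X → X → S
  iq : X → X → T
  ip_actL : ∀ (s : S) (x y : X), ip (actL s x) y = s * ip x y
  ip_symm : ∀ x y : X, ip y x = (ip x y)⁻¹
  ip_self_act : ∀ x : X, actL (ip x x) x = x
  iq_actR : ∀ (x y : X) (t : T), iq x (actR y t) = iq x y * t
  iq_symm : ∀ x y : X, iq y x = (iq x y)⁻¹
  iq_self_act : ∀ x : X, actR x (iq x x) = x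
  ip_iq_assoc : ∀ x y z : X, actL (ip x y) z = actR x (iq y z)

namespace Biaction

variable {S T : Type*} [InverseSemigroup S] [InverseSemigroup T] {X : Type*}

/-- Left compatibility in a biaction: `p(x) y = p(y) x` with `p x = ⟨x,x⟩`. -/
def LCompatX (B : Biaction S T X) (x y : X) : Prop :=
  B.actL (B.ip x x) y = B.actL (B.ip y y) x

/-- Right compatibility in a biaction: `x q(y) = y q(x)` with `q x = [x,x]`. -/
def RCompatX (B : Biaction S T X) (x y : X) : Prop :=
  B.actR x (B.iq y y) = B.actR y (B.iq x x)

/-- Compatibility in a biaction. -/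
def CompatX (B : Biaction S T X) (x y : X) : Prop := B.LCompatX x y ∧ B.RCompatX x y

/-- A compatible subset of `X`. -/
def CompatSetX (B : Biaction S T X) (A : Set X) : Prop := ∀ x ∈ A, ∀ y ∈ A, B.CompatX x y

/-- The order on `X`: `x ≤ y` iff `x = e • y` for some idempotent `e ∈ S`. -/
def bxle (B : Biaction S T X) (x y : X) : Prop := ∃ e : S, IsIdem e ∧ x = B.actL e y

/-- `j` is the join of `A ⊆ X`. -/
def IsJoinBX (B : Biaction S T X) (A : Set X) (j : X) : Prop :=
  (∀ a ∈ A, B.bxle a j) ∧ ∀ b : X, (∀ a ∈ A, B.bxle a b) → B.bxle j b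

end Biaction

/-- An `(S,T)`-bimodule over pseudogroups `S` and `T`. -/
structure Bimodule (S T : Type*) [Pseudogroup S] [Pseudogroup T] (X : Type*) extends
    Biaction S T X where
  joinsX : ∀ A : Set X, toBiaction.CompatSetX A → ∃ j : X, toBiaction.IsJoinBX A j
  distL : ∀ (s : S) (A : Set X) (j : X), toBiaction.CompatSetX A → toBiaction.IsJoinBX A j →
    toBiaction.IsJoinBX (toBiaction.actL s '' A) (toBiaction.actL s j)
  distSL : ∀ (A : Set S) (j : S), CompatSet A → IsJoin A j → ∀ x : X,
    toBiaction.IsJoinBX ((fun s => toBiaction.actL s x) '' A) (toBiaction.actL j x)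
  distR : ∀ (t : T) (A : Set X) (j : X), toBiaction.CompatSetX A → toBiaction.IsJoinBX A j →
    toBiaction.IsJoinBX ((fun x => toBiaction.actR x t) '' A) (toBiaction.actR j t)
  distTR : ∀ (A : Set T) (j : T), CompatSet A → IsJoin A j → ∀ x : X,
    toBiaction.IsJoinBX ((fun t => toBiaction.actR x t) '' A) (toBiaction.actR x j)
  distIP : ∀ (A : Set X) (j : X), toBiaction.CompatSetX A → toBiaction.IsJoinBX A j → ∀ y : X,
    IsJoin ((fun x => toBiaction.ip x y) '' A) (toBiaction.ip j y)
  distIQ : ∀ (A : Set X) (j : X), toBiaction.CompatSetX A → toBiaction.IsJoinBX A j → ∀ y : X,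
    IsJoin ((fun x => toBiaction.iq y x) '' A) (toBiaction.iq y j)

/-- An `(S,T)`-equivalence bimodule: an `(S,T)`-bimodule satisfying both covering
conditions `⋁_{x∈X} ⟨x,x⟩ = e_S` and `⋁_{x∈X} [x,x] = e_T`
(where `e_S = ⋁ E(S)` and `e_T = ⋁ E(T)`). -/
structure EquivBimodule (S T : Type*) [Pseudogroup S] [Pseudogroup T] (X : Type*) extends
    Bimodule S T X where
  coverS : ∀ jS : S, IsJoin {e : S | IsIdem e} jS →
    IsJoin (Set.range fun x : X => toBimodule.toBiaction.ip x x) jS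
  coverT : ∀ jT : T, IsJoin {e : T | IsIdem e} jT →
    IsJoin (Set.range fun x : X => toBimodule.toBiaction.iq x x) jT


theorem idem_inv {S : Type*} [InverseSemigroup S] {e : S} (he : IsIdem e) : e⁻¹ = e := by
  unfold IsIdem at he
  exact (InverseSemigroup.inv_unique e e (by rw [he, he]) (by rw [he, he])).symm

theorem idem_mul {S : Type*} [InverseSemigroup S] {e f : S} (he : IsIdem e) (hf : IsIdem f) :
    IsIdem (e * f) := by
  have h1 := InverseSemigroup.mul_inv_mul (e * f)
  have h2 := InverseSemigroup.inv_mul_inv (e * f)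
  have h3 := InverseSemigroup.inv_unique (e * f) (f * (e * f)⁻¹ * e)
  have h4 := InverseSemigroup.inv_unique (e * f)⁻¹ (e * f) h2 h1
  generalize (e * f)⁻¹ = x at *
  have he' : ∀ z, e * (e * z) = e * z := fun z => by rw [← mul_assoc, he]
  have hf' : ∀ z, f * (f * z) = f * z := fun z => by rw [← mul_assoc, hf]
  have h2' : ∀ z, x * (e * (f * (x * z))) = x * z := fun z => by
    conv_rhs => rw [← h2]
    simp only [mul_assoc]
  have h5 : f * x * e = x := by
    apply h3
    · simp only [mul_assoc, he', hf']
      simpa only [mul_assoc] using h1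
    · simp only [mul_assoc, he', hf', h2']
  have hx : IsIdem x := by
    unfold IsIdem
    conv_lhs => rw [← h5]
    simp only [mul_assoc, h2']
    simpa only [mul_assoc] using h5
  rw [h4, idem_inv hx]
  exact hx

theorem idem_comm {S : Type*} [InverseSemigroup S] {e f : S} (he : IsIdem e) (hf : IsIdem f) :
    e * f = f * e := by
  have h1 := idem_mul he hf
  have h2 := idem_mul hf he
  have he' : ∀ z, e * (e * z) = e * z := fun z => by rw [← mul_assoc, he]
  have hf' : ∀ z, f * (f * z) = f * z := fun z => by rw [← mul_assoc, hf]
  have h3 := InverseSemigroup.inv_unique (e * f) (f * e)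
    (by simp only [mul_assoc, he', hf']; simpa only [IsIdem, mul_assoc] using h1)
    (by simp only [mul_assoc, he', hf']; simpa only [IsIdem, mul_assoc] using h2)
  rw [h3, idem_inv h1]

theorem idem_conj {S : Type*} [InverseSemigroup S] {e f : S} (he : IsIdem e) (hf : IsIdem f) :
    e * f * e⁻¹ = e * f := by
  rw [idem_inv he, mul_assoc, idem_comm hf he, ← mul_assoc, he]

/-- In a left `S`-module, if a family `(xᵢ)` has a join `j`, then
`p j` is the join of the family `(p xᵢ)`. -/
theorem statement2 {S X : Type*} [Pseudogroup S] (M : SMod S X)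
    {ι : Type*} (x : ι → X) (j : X)
    (hj : M.toSupportedAction.IsJoinX (Set.range x) j) :
    IsJoin (Set.range fun i => M.toSupportedAction.p (x i)) (M.toSupportedAction.p j) := by
  have hp : ∀ i, nle (M.p (x i)) (M.p j) ∧ M.act (M.p (x i)) j = x i := by
    intro i
    obtain ⟨e, he, hx⟩ := hj.1 (x i) ⟨i, rfl⟩
    have h : M.p (x i) = e * M.p j := by
      rw [hx, M.p_conj, idem_conj he (M.p_idem j)]
    refine ⟨⟨e, he, h⟩, ?_⟩
    rw [h, M.act_mul, M.p_act, ← hx]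
  have hle : ∀ a ∈ Set.range (fun i => M.p (x i)), nle a (M.p j) := by
    rintro _ ⟨i, rfl⟩
    exact (hp i).1
  refine ⟨hle, ?_⟩
  have hc : CompatSet (Set.range fun i => M.p (x i)) := by
    rintro _ ⟨i, rfl⟩ _ ⟨k, rfl⟩
    constructor
    · unfold LeftCompat
      rw [idem_inv (M.p_idem _)]
      exact idem_mul (M.p_idem _) (M.p_idem _)
    · unfold RightCompat
      rw [idem_inv (M.p_idem _)]
      exact idem_mul (M.p_idem _) (M.p_idem _)
  obtain ⟨e, hub, hlub⟩ := Pseudogroup.joins_exist _ hc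
  have hei : IsIdem e := by
    obtain ⟨f, hf, h⟩ := hlub _ hle
    rw [h]
    exact idem_mul hf (M.p_idem j)
  obtain ⟨g, hg, hgj⟩ := hj.2 (M.act e j) (by
    rintro _ ⟨i, rfl⟩
    obtain ⟨f, hf, h⟩ := hub _ ⟨i, rfl⟩
    refine ⟨f, hf, ?_⟩
    rw [← M.act_mul, ← h]
    exact (hp i).2.symm)
  have hpj : M.p j = M.p j * g * e := by
    have h : M.p j = g * e * M.p j := by
      conv_lhs => rw [hgj, ← M.act_mul, M.p_conj, idem_conj (idem_mul hg hei) (M.p_idem j)]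
    rw [idem_comm (idem_mul hg hei) (M.p_idem j), ← mul_assoc] at h
    exact h
  intro b hb
  obtain ⟨f, hf, h⟩ := hlub b hb
  refine ⟨M.p j * g * f, idem_mul (idem_mul (M.p_idem j) hg) hf, ?_⟩
  rw [mul_assoc, ← h]
  exact hpj

end PseudogroupMorita
end

section
/- Let S and T be pseudogroups with identities e_S and e_T, and let X be an (S,T)-bimodule. Then: (1) (im ⟨-,-⟩)^∨ = S if and only if ⋁_{x∈X} ⟨x,x⟩ = e_S; (2) (im [-,-])^∨ = T if and only if ⋁_{x∈X} [x,x] = e_T. Here, for a subset A of a pseudogroup, A^∨ denotes the set of all joins of compatible subsets of A. -/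
namespace PseudogroupMorita

section Helpers
variable {S : Type*} [InverseSemigroup S]

open InverseSemigroup

theorem aux_inv_inv (a : S) : a⁻¹⁻¹ = a :=
  (inv_unique a⁻¹ a (inv_mul_inv a) (mul_inv_mul a)).symm

theorem aux_idem_inv {e : S} (he : IsIdem e) : e⁻¹ = e := by
  have h : e * e = e := he
  exact (inv_unique e e (by rw [h, h]) (by rw [h, h])).symm

theorem aux_idem_mul {e f : S} (he : IsIdem e) (hf : IsIdem f) : IsIdem (e * f) := by
  have h1 : e * e = e := he
  have h2 : f * f = f := hf
  have h1' : ∀ x, e * (e * x) = e * x := fun x => by rw [← mul_assoc, h1]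
  have h2' : ∀ x, f * (f * x) = f * x := fun x => by rw [← mul_assoc, h2]
  have m1 := mul_inv_mul (e * f)
  have m2 := inv_mul_inv (e * f)
  have m3 := aux_inv_inv (e * f)
  have m4 := inv_unique (e * f) (f * (e * f)⁻¹ * e)
  generalize (e * f)⁻¹ = b at m1 m2 m3 m4
  simp only [mul_assoc] at m1 m2 m4
  have m2' : ∀ x, b * (e * (f * (b * x))) = b * x := fun x => by
    have := congrArg (· * x) m2
    simpa only [mul_assoc] using this
  have hb := m4 (by rw [h2', h1', m1]) (by rw [h1', h2', m2'])
  have hbb : b * b = b := by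
    calc b * b = (f * (b * e)) * (f * (b * e)) := by rw [hb]
      _ = f * (b * e) := by simp only [mul_assoc]; rw [m2']
      _ = b := hb
  have : b = e * f := by rw [← m3, aux_idem_inv hbb]
  rw [← this]; exact hbb

theorem aux_comm {e f : S} (he : IsIdem e) (hf : IsIdem f) : e * f = f * e := by
  have h1 : e * e = e := he
  have h2 : f * f = f := hf
  have h1' : ∀ x, e * (e * x) = e * x := fun x => by rw [← mul_assoc, h1]
  have h2' : ∀ x, f * (f * x) = f * x := fun x => by rw [← mul_assoc, h2]
  have k1 : (e * f) * (e * f) = e * f := aux_idem_mul he hf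
  have k2 : (f * e) * (f * e) = f * e := aux_idem_mul hf he
  have := inv_unique (e * f) (f * e)
    (by simp only [mul_assoc] at *; rw [h2', h1', k1])
    (by simp only [mul_assoc] at *; rw [h1', h2', k2])
  rw [this, aux_idem_inv k1]

theorem aux_mul_inv (a b : S) : (a * b)⁻¹ = b⁻¹ * a⁻¹ := by
  have ia : IsIdem (a⁻¹ * a) := by
    unfold IsIdem; rw [← mul_assoc, inv_mul_inv]
  have ib : IsIdem (b * b⁻¹) := by
    unfold IsIdem; rw [← mul_assoc, mul_inv_mul]
  have hc := aux_comm ia ib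
  refine (inv_unique _ _ ?_ ?_).symm
  · calc a * b * (b⁻¹ * a⁻¹) * (a * b) = a * ((b * b⁻¹) * (a⁻¹ * a)) * b := by
          simp only [mul_assoc]
      _ = (a * a⁻¹ * a) * (b * b⁻¹ * b) := by rw [← hc]; simp only [mul_assoc]
      _ = a * b := by rw [mul_inv_mul, mul_inv_mul]
  · calc b⁻¹ * a⁻¹ * (a * b) * (b⁻¹ * a⁻¹) = b⁻¹ * ((a⁻¹ * a) * (b * b⁻¹)) * a⁻¹ := by
          simp only [mul_assoc]
      _ = (b⁻¹ * b * b⁻¹) * (a⁻¹ * a * a⁻¹) := by rw [hc]; simp only [mul_assoc]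
      _ = b⁻¹ * a⁻¹ := by rw [inv_mul_inv, inv_mul_inv]

theorem aux_inv_mul_idem (a : S) : IsIdem (a⁻¹ * a) := by
  unfold IsIdem; rw [← mul_assoc, inv_mul_inv]

theorem aux_mul_inv_idem (a : S) : IsIdem (a * a⁻¹) := by
  unfold IsIdem; rw [← mul_assoc, mul_inv_mul]

theorem aux_conj {e : S} (he : IsIdem e) (s : S) : IsIdem (s * e * s⁻¹) := by
  have h1 : e * e = e := he
  have hc := aux_comm he (aux_inv_mul_idem s)
  unfold IsIdem
  calc s * e * s⁻¹ * (s * e * s⁻¹) = s * (e * (s⁻¹ * s)) * e * s⁻¹ := by simp only [mul_assoc]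
    _ = (s * s⁻¹ * s) * (e * e) * s⁻¹ := by rw [hc]; simp only [mul_assoc]
    _ = s * e * s⁻¹ := by rw [mul_inv_mul, h1]

theorem aux_trans {a b c : S} (h : nle a b) (h' : nle b c) : nle a c := by
  obtain ⟨e, he, rfl⟩ := h
  obtain ⟨f, hf, rfl⟩ := h'
  exact ⟨e * f, aux_idem_mul he hf, (mul_assoc _ _ _).symm⟩

theorem aux_idem_unit {u e : S} (hu : IsJoin {e : S | IsIdem e} u) (he : IsIdem e) :
    e * u = e := by
  obtain ⟨f, hf, h⟩ := hu.1 e he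
  have h1 : f * f = f := hf
  have h2 : e * e = e := he
  calc e * u = (e * e) * u := by rw [h2]
    _ = e * (f * u) * u := by rw [← h]
    _ = (e * f) * u * u := by simp only [mul_assoc]
    _ = f * e * u * u := by rw [aux_comm he hf]
    _ = e := ?_
  have hfe : f * e = e := by rw [h, ← mul_assoc, h1]
  rw [hfe]
  have heu : e * u = e := by
    calc e * u = (f * e) * u := by rw [hfe]
      _ = e * f * u := by rw [aux_comm he hf]
      _ = e := by rw [mul_assoc, ← h, h2]
  rw [heu, heu]

theorem aux_unit {u : S} (hu : IsJoin {e : S | IsIdem e} u) (s : S) : s * u = s := by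
  calc s * u = s * (s⁻¹ * s * u) := by
        rw [← mul_assoc, ← mul_assoc, mul_inv_mul]
    _ = s := by rw [aux_idem_unit hu (aux_inv_mul_idem s), ← mul_assoc, mul_inv_mul]

end Helpers

theorem aux_main {S X : Type*} [Pseudogroup S] (u : S) (hu : IsJoin {e : S | IsIdem e} u)
    (I : Set S) (p : X → S) (hp : ∀ x, IsIdem (p x))
    (h1 : ∀ a ∈ I, ∃ x, p x * a = a ∨ a * p x = a)
    (h2 : ∀ s x, s * p x ∈ I) :
    supClosure I = Set.univ ↔ IsJoin (Set.range p) u := by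
  constructor
  · intro h
    obtain ⟨C, hC, -, hj⟩ : u ∈ supClosure I := by rw [h]; trivial
    refine ⟨?_, fun b hb => hj.2 b fun c hc => ?_⟩
    · rintro _ ⟨x, rfl⟩
      exact hu.1 _ (hp x)
    · obtain ⟨x, hx⟩ := h1 c (hC hc)
      have hci : IsIdem c := by
        obtain ⟨e, he, h⟩ := hj.1 c hc
        rw [aux_idem_unit hu he] at h
        rw [h]; exact he
      refine aux_trans ?_ (hb (p x) ⟨x, rfl⟩)
      refine ⟨c, hci, ?_⟩
      rcases hx with hx | hx
      · rw [aux_comm hci (hp x), hx]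
      · exact hx.symm
  · intro h
    refine Set.eq_univ_of_forall fun s => ?_
    have hR : CompatSet (Set.range p) := by
      rintro _ ⟨x, rfl⟩ _ ⟨y, rfl⟩
      constructor
      · unfold LeftCompat
        rw [aux_idem_inv (hp x)]
        exact aux_idem_mul (hp x) (hp y)
      · unfold RightCompat
        rw [aux_idem_inv (hp y)]
        exact aux_idem_mul (hp x) (hp y)
    have hj := Pseudogroup.mul_join_left s _ _ hR h
    rw [aux_unit hu] at hj
    refine ⟨_, ?_, ?_, hj⟩
    · rintro _ ⟨_, ⟨x, rfl⟩, rfl⟩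
      exact h2 s x
    · rintro _ ⟨_, ⟨x, rfl⟩, rfl⟩ _ ⟨_, ⟨y, rfl⟩, rfl⟩
      constructor
      · have := aux_idem_mul (aux_idem_mul (hp x) (aux_inv_mul_idem s)) (hp y)
        simp only [LeftCompat, aux_mul_inv, aux_idem_inv (hp x)]
        simpa only [mul_assoc] using this
      · have := aux_conj (aux_idem_mul (hp x) (hp y)) s
        simp only [RightCompat, aux_mul_inv, aux_idem_inv (hp y)]
        simpa only [mul_assoc] using this

/-- **Covering conditions.** For an `(S,T)`-bimodule `X`:
`(im ⟨-,-⟩)^∨ = S` iff `⋁_{x∈X} ⟨x,x⟩ = e_S`, and `(im [-,-])^∨ = T` iff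
`⋁_{x∈X} [x,x] = e_T`, where `e_S = ⋁ E(S)` and `e_T = ⋁ E(T)` are the identities. -/
theorem statement10 {S T X : Type*} [Pseudogroup S] [Pseudogroup T] (B : Bimodule S T X)
    (eS : S) (heS : IsJoin {e : S | IsIdem e} eS)
    (eT : T) (heT : IsJoin {e : T | IsIdem e} eT) :
    (supClosure {s : S | ∃ x y : X, B.toBiaction.ip x y = s} = Set.univ ↔
      IsJoin (Set.range fun x : X => B.toBiaction.ip x x) eS) ∧
    (supClosure {t : T | ∃ x y : X, B.toBiaction.iq x y = t} = Set.univ ↔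
      IsJoin (Set.range fun x : X => B.toBiaction.iq x x) eT) := by
  constructor
  · refine aux_main eS heS _ _ (fun x => ?_) ?_ (fun s x => ⟨B.actL s x, x, B.ip_actL s x x⟩)
    · unfold IsIdem
      rw [← B.ip_actL, B.ip_self_act]
    · rintro _ ⟨x, y, rfl⟩
      exact ⟨x, Or.inl (by rw [← B.ip_actL, B.ip_self_act])⟩
  · refine aux_main eT heT _ _ (fun x => ?_) ?_ (fun t x => ⟨B.actR x t⁻¹, x, ?_⟩)
    · unfold IsIdem
      rw [← B.iq_actR, B.iq_self_act]
    · rintro _ ⟨x, y, rfl⟩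
      exact ⟨y, Or.inr (by rw [← B.iq_actR, B.iq_self_act])⟩
    · rw [B.iq_symm x, B.iq_actR, aux_mul_inv, aux_inv_inv, ← B.iq_symm]

end PseudogroupMorita
end
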